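/- Let X be a compact set in C^n and z in X. Suppose that for every neighborhood V of z there is a negative continuous plurisubharmonic function u in PSH^c(X) such that u(z) = -1 and u(w) <= -2 for all w in X not in V. Then there is a continuous plurisubharmonic function u in PSH^c(X) such that u(z) = 0 and u(w) < 0 for all w in X different from z. -/

import Mathlib

open MeasureTheory Metric Filter Topology Set Complex
open scoped ENNReal

noncomputable section

/-- `ℂⁿ`. -/
abbrev En (n : ℕ) : Type := EuclideanSpace ℂ (Fin n)

instance (n : ℕ) : MeasurableSpace (En n) := borel _

instance (n : ℕ) : BorelSpace (En n) := ⟨rfl⟩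

open Classical in
/-- The positive part of an extended real number, as an element of `ℝ≥0∞`. -/
def epos (x : EReal) : ℝ≥0∞ := if x = ⊤ then ⊤ else ENNReal.ofReal x.toReal

/-- The integral of an `EReal`-valued function `u` against a measure `μ`, defined as the
difference of the lower integrals of the positive and negative parts of `u`. -/
def eint {α : Type*} [MeasurableSpace α] (μ : Measure α) (u : α → EReal) : EReal :=
  ((∫⁻ x, epos (u x) ∂μ : ℝ≥0∞) : EReal) - ((∫⁻ x, epos (-(u x)) ∂μ : ℝ≥0∞) : EReal)

/-- The normalized angular measure `(2π)⁻¹ dθ` on `[0, 2π)`. -/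
def thetaM : Measure ℝ :=
  (ENNReal.ofReal ((2 * Real.pi)⁻¹)) • (volume.restrict (Set.Ico (0 : ℝ) (2 * Real.pi)))

/-- A function `u` with values in `[-∞, ∞)` is plurisubharmonic on an open set `U ⊆ ℂⁿ`:
it is upper semicontinuous, `< ⊤`, and satisfies the sub-mean-value inequality on every
complex line. -/
def PshOnE {n : ℕ} (u : En n → EReal) (U : Set (En n)) : Prop :=
  UpperSemicontinuousOn u U ∧ (∀ z ∈ U, u z < ⊤) ∧
  ∀ z ∈ U, ∀ w : En n, ∀ r : ℝ, 0 < r →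
    (∀ ζ : ℂ, ‖ζ‖ ≤ r → z + ζ • w ∈ U) →
    u z ≤ eint thetaM (fun θ => u (z + (circleMap 0 r θ) • w))

/-- `μ` is a Jensen measure on `X` with barycenter `z`:  a Borel probability measure
supported on `X` such that `u z ≤ ∫ u dμ` for every function `u` continuous and
plurisubharmonic on some open neighborhood of `X`. -/
def IsJensen {n : ℕ} (X : Set (En n)) (z : En n) (μ : Measure (En n)) : Prop :=
  IsProbabilityMeasure μ ∧ μ Xᶜ = 0 ∧
  ∀ U : Set (En n), IsOpen U → X ⊆ U →
    ∀ u : En n → EReal, ContinuousOn u U → PshOnE u U → u z ≤ eint μ u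

/-- `u : X → [-∞, ∞)` is plurisubharmonic on the compact set `X` : it is upper
semicontinuous on `X`, `< ⊤` on `X`, and satisfies the subaveraging inequality with respect
to all Jensen measures on `X`. -/
def PSHe {n : ℕ} (X : Set (En n)) (u : En n → EReal) : Prop :=
  UpperSemicontinuousOn u X ∧ (∀ z ∈ X, u z < ⊤) ∧
  ∀ z ∈ X, ∀ μ : Measure (En n), IsJensen X z μ → u z ≤ eint μ u

/-- `PSH^c(X)`: continuous plurisubharmonic functions on `X`. -/
def PSHce {n : ℕ} (X : Set (En n)) (u : En n → EReal) : Prop :=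
  PSHe X u ∧ ContinuousOn u X

/-- Real-valued continuous plurisubharmonic functions on `X`. -/
def PSHcR {n : ℕ} (X : Set (En n)) (u : En n → ℝ) : Prop :=
  ContinuousOn u X ∧ PSHe X (fun x => (u x : EReal))

/-- `O_X`: the set of points `z ∈ X` whose only Jensen measure is `δ_z`. -/
def Oset {n : ℕ} (X : Set (En n)) : Set (En n) :=
  {z | z ∈ X ∧ ∀ μ : Measure (En n), IsJensen X z μ → μ = Measure.dirac z}

/-- The potential boundary `B_X`, the closure of `O_X`. -/
def Bset {n : ℕ} (X : Set (En n)) : Set (En n) := closure (Oset X)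

/-- `J^b_z(X)`: Jensen measures with barycenter `z` supported on `B_X`. -/
def IsJensenB {n : ℕ} (X : Set (En n)) (z : En n) (μ : Measure (En n)) : Prop :=
  IsJensen X z μ ∧ μ (Bset X)ᶜ = 0

/-- `ν` is subordinated to `μ` : `μ(u) ≥ ν(u)` for all `u ∈ PSH^c(X)`. -/
def Subord {n : ℕ} (X : Set (En n)) (μ ν : Measure (En n)) : Prop :=
  ∀ u : En n → EReal, PSHce X u → eint ν u ≤ eint μ u

/-- Subharmonic functions with values in `[-∞, ∞)` on an open set `U ⊆ ℂ`. -/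
def SubharmOn (u : ℂ → EReal) (U : Set ℂ) : Prop :=
  UpperSemicontinuousOn u U ∧ (∀ z ∈ U, u z < ⊤) ∧
  ∀ z ∈ U, ∀ r : ℝ, 0 < r → closedBall z r ⊆ U →
    u z ≤ eint thetaM (fun θ => u (circleMap z r θ))

/-- Harmonic (real-valued) functions on an open set `U ⊆ ℂ`: continuous functions
satisfying the mean-value equality. -/
def HarmOn (h : ℂ → ℝ) (U : Set ℂ) : Prop :=
  ContinuousOn h U ∧
  ∀ z ∈ U, ∀ r : ℝ, 0 < r → closedBall z r ⊆ U →
    h z = (2 * Real.pi)⁻¹ * ∫ θ in (0 : ℝ)..(2 * Real.pi), h (circleMap z r θ)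

/-- Superharmonic (real-valued) functions on an open set `U ⊆ ℂ`. -/
def SuperharmOn (v : ℂ → ℝ) (U : Set ℂ) : Prop :=
  LowerSemicontinuousOn v U ∧
  ∀ z ∈ U, ∀ r : ℝ, 0 < r → closedBall z r ⊆ U →
    (2 * Real.pi)⁻¹ * (∫ θ in (0 : ℝ)..(2 * Real.pi), v (circleMap z r θ)) ≤ v z

/-- The infimum of all positive superharmonic functions on the unit disk, extending
continuously to the closed disk and `≥ 1` on `A`, evaluated at `z`. -/
def hmPre (A : Set ℂ) (z : ℂ) : ℝ :=
  sInf {t : ℝ | ∃ v : ℂ → ℝ, SuperharmOn v (ball 0 1) ∧ (∀ w ∈ ball (0 : ℂ) 1, 0 < v w) ∧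
    ContinuousOn v (closedBall 0 1) ∧ (∀ w ∈ A, 1 ≤ v w) ∧ t = v z}

/-- The harmonic measure `ω(z, A, 𝔻)` of `A` with respect to the unit disk. -/
def hm (z : ℂ) (A : Set ℂ) : ℝ := Filter.liminf (fun w => hmPre A w) (𝓝 z)

open Classical in
/-- The radial limit of a map `f` at the boundary point `ζ` of the unit circle
(junk value `0` if the radial limit does not exist). -/
def bval {n : ℕ} (f : ℂ → En n) (ζ : ℂ) : En n :=
  if h : ∃ l : En n, Tendsto (fun r : ℝ => f ((r : ℂ) * ζ)) (𝓝[<] (1 : ℝ)) (𝓝 l)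
  then h.choose else 0

open Classical in
/-- The radial limit of an `EReal`-valued function on the disk at the boundary point `ζ`. -/
def bvalE (g : ℂ → EReal) (ζ : ℂ) : EReal :=
  if h : ∃ l : EReal, Tendsto (fun r : ℝ => g ((r : ℂ) * ζ)) (𝓝[<] (1 : ℝ)) (𝓝 l)
  then h.choose else 0

/-- `μ_f`: the push-forward of the normalized arclength measure on the unit circle under the
radial boundary values of `f`. -/
def bmeas {n : ℕ} (f : ℂ → En n) : Measure (En n) :=
  thetaM.map (fun θ => bval f (circleMap 0 1 θ))

/-- Weak-* convergence of a sequence of measures on `ℂⁿ`. -/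
def WeakConv {n : ℕ} (μs : ℕ → Measure (En n)) (μ : Measure (En n)) : Prop :=
  ∀ φ : BoundedContinuousFunction (En n) ℝ,
    Tendsto (fun j => ∫ x, φ x ∂(μs j)) atTop (𝓝 (∫ x, φ x ∂μ))

/-- The cluster set `cl L` of a sequence of maps of the unit disk into `ℂⁿ`. -/
def clusterSet {n : ℕ} (f : ℕ → ℂ → En n) : Set (En n) :=
  {z | ∀ r : ℝ, 0 < r → ∀ N : ℕ, ∃ j, N ≤ j ∧ ∃ ζ ∈ ball (0 : ℂ) 1, f j ζ ∈ ball z r}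

/-- A point `z` is totally essential for the sequence `f` if for every open set `V ∋ z` the
harmonic measures at `0` of `f j ⁻¹' V` stay bounded away from `0`. -/
def TotallyEssential {n : ℕ} (f : ℕ → ℂ → En n) (z : En n) : Prop :=
  ∀ V : Set (En n), IsOpen V → z ∈ V →
    0 < Filter.atTop.liminf (fun j => hm 0 ((f j ⁻¹' V) ∩ ball 0 1))

/-- A totally perfect sequence `L` of holomorphic maps of the unit disk into `ℂⁿ`: a
uniformly bounded sequence of holomorphic maps which is weak-* converging (with limit measure
`μ_L` and center `z_L`) and all of whose cluster points are totally essential. -/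
structure PerfectSeq (n : ℕ) where
  f : ℕ → ℂ → En n
  holo : ∀ j, DifferentiableOn ℂ (f j) (ball 0 1)
  bdd : ∃ C : ℝ, ∀ j, ∀ ζ ∈ ball (0 : ℂ) 1, ‖f j ζ‖ ≤ C
  μL : Measure (En n)
  conv : WeakConv (fun j => bmeas (f j)) μL
  zL : En n
  center : Tendsto (fun j => f j 0) atTop (𝓝 zL)
  ess : ∀ z ∈ clusterSet f, TotallyEssential f z

/-- `J_z^s(L)`: the measures obtained as weak-* limits of `μ_{f_{j_k} ∘ g_k}` for subsequences
`{j_k}` and holomorphic maps `g_k : 𝔻 → 𝔻` with `f_{j_k}(g_k(0)) → z`. -/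
def JsSet {n : ℕ} (L : PerfectSeq n) (z : En n) : Set (Measure (En n)) :=
  {μ | ∃ jk : ℕ → ℕ, StrictMono jk ∧ ∃ g : ℕ → ℂ → ℂ,
    (∀ k, DifferentiableOn ℂ (g k) (ball 0 1) ∧ MapsTo (g k) (ball 0 1) (ball 0 1)) ∧
    WeakConv (fun k => bmeas ((L.f (jk k)) ∘ (g k))) μ ∧
    Tendsto (fun k => L.f (jk k) (g k 0)) atTop (𝓝 z)}

/-- `J_z(L)`: the convex hull of `J_z^s(L)`. -/
def JLSet {n : ℕ} (L : PerfectSeq n) (z : En n) : Set (Measure (En n)) :=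
  {μ | ∃ (m : ℕ) (w : Fin m → ℝ) (ν : Fin m → Measure (En n)),
    (∀ i, 0 ≤ w i) ∧ (∑ i, w i = 1) ∧ (∀ i, ν i ∈ JsSet L z) ∧
    μ = ∑ i, (ENNReal.ofReal (w i)) • ν i}

/-- `u` is harmonic on the totally perfect sequence `L`. -/
def HarmonicOnL {n : ℕ} (L : PerfectSeq n) (u : En n → EReal) : Prop :=
  PSHce (clusterSet L.f) u ∧
  ∀ z ∈ clusterSet L.f, ∀ μ ∈ JLSet L z, eint μ u = u z

/-- `PSH^w(X)`: weakly plurisubharmonic functions, the upper envelopes of nonempty families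
of continuous plurisubharmonic functions on `X`. -/
def PSHw {n : ℕ} (X : Set (En n)) (u : En n → EReal) : Prop :=
  ∃ F : Set (En n → EReal), F.Nonempty ∧ (∀ v ∈ F, PSHce X v) ∧
    ∀ x ∈ X, u x = ⨆ v ∈ F, v x

/-- `u` is maximal on `X ∖ Z`: for every relatively open `V ⊆ X ∖ Z` and every
`v ∈ PSH^c(closure V)`, if `v ≤ u` on the relative boundary of `V` in `X` then `v ≤ u`
on `closure V`. -/
def MaximalOn {n : ℕ} (X Z : Set (En n)) (u : En n → EReal) : Prop :=
  ∀ W : Set (En n), IsOpen W → X ∩ W ⊆ X \ Z →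
    ∀ v : En n → EReal, PSHce (closure (X ∩ W)) v →
      (∀ x ∈ closure (X ∩ W) \ (X ∩ W), v x ≤ u x) →
      ∀ x ∈ closure (X ∩ W), v x ≤ u x

/-- Pluriharmonic continuous real-valued functions on `X`. -/
def Pluriharm {n : ℕ} (X : Set (En n)) (h : En n → ℝ) : Prop :=
  ContinuousOn h X ∧
  ∀ z ∈ X, ∀ μ : Measure (En n), IsJensen X z μ → (h z : EReal) = eint μ (fun x => (h x : EReal))

/-- `X` is a Poisson set: every continuous real-valued function on `B_X` extends to a
pluriharmonic function on `X`. -/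
def PoissonSet {n : ℕ} (X : Set (En n)) : Prop :=
  ∀ φ : En n → ℝ, ContinuousOn φ (Bset X) →
    ∃ h : En n → ℝ, Pluriharm X h ∧ ∀ w ∈ Bset X, h w = φ w

end

/-- `v` is real-valued, continuous on `X`, bounded by `1` there, and subaveraging with respect to
all Jensen measures on `X`. -/
structure UnitSubaveraging {n : ℕ} (X : Set (En n)) (v : En n → ℝ) : Prop where
  continuousOn : ContinuousOn v X
  norm_le : ∀ x ∈ X, ‖v x‖ ≤ 1
  le_integral : ∀ x ∈ X, ∀ μ : Measure (En n), IsJensen X x μ → v x ≤ ∫ y, v y ∂μ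

theorem epos_coe (x : ℝ) : epos (x : EReal) = ENNReal.ofReal x := by
  simp [epos]

theorem epos_mono {x y : EReal} (h : x ≤ y) : epos x ≤ epos y := by
  induction y with
  | top => simp [epos]
  | bot => rw [le_bot_iff.mp h]
  | coe b =>
    induction x with
    | top => simp at h
    | bot => simp [epos]
    | coe a => simpa only [epos_coe] using ENNReal.ofReal_le_ofReal (EReal.coe_le_coe_iff.mp h)

theorem eint_mono_ae {α : Type*} [MeasurableSpace α] {μ : Measure α} {u v : α → EReal}
    (h : ∀ᵐ x ∂μ, u x ≤ v x) : eint μ u ≤ eint μ v := by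
  refine EReal.sub_le_sub ?_ ?_
  · exact EReal.coe_ennreal_le_coe_ennreal_iff.mpr
      (lintegral_mono_ae (h.mono fun x hx => epos_mono hx))
  · exact EReal.coe_ennreal_le_coe_ennreal_iff.mpr
      (lintegral_mono_ae (h.mono fun x hx => epos_mono (EReal.neg_le_neg_iff.mpr hx)))

theorem eint_coe {α : Type*} [MeasurableSpace α] {μ : Measure α} {f : α → ℝ}
    (hf : Integrable f μ) : eint μ (fun x => (f x : EReal)) = ((∫ x, f x ∂μ : ℝ) : EReal) := by
  have hpos : ∫⁻ x, ENNReal.ofReal (f x) ∂μ ≠ ⊤ := hf.lintegral_lt_top.ne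
  have hneg : ∫⁻ x, ENNReal.ofReal (-f x) ∂μ ≠ ⊤ := hf.neg.lintegral_lt_top.ne
  rw [integral_eq_lintegral_pos_part_sub_lintegral_neg_part hf, EReal.coe_sub,
    EReal.coe_ennreal_toReal hpos, EReal.coe_ennreal_toReal hneg]
  simp only [eint, ← EReal.coe_neg, epos_coe]

theorem IsJensen.ae_mem {n : ℕ} {X : Set (En n)} {x : En n} {μ : Measure (En n)}
    (h : IsJensen X x μ) : ∀ᵐ y ∂μ, y ∈ X :=
  mem_ae_iff.mpr h.2.1

theorem IsJensen.integrable {n : ℕ} {X : Set (En n)} (hX : IsCompact X) {x : En n}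
    {μ : Measure (En n)} (h : IsJensen X x μ) {f : En n → ℝ} (hf : ContinuousOn f X) :
    Integrable f μ := by
  have := h.1
  have hr : μ.restrict X = μ := Measure.restrict_eq_self_of_ae_mem h.ae_mem
  rw [← hr]
  exact hf.integrableOn_compact hX

theorem exists_unitSubaveraging_of_psh {n : ℕ} {X : Set (En n)} (hX : IsCompact X)
    {u : En n → EReal} (hu : PSHce X u) (hneg : ∀ w ∈ X, u w < 0) :
    ∃ v : En n → ℝ, UnitSubaveraging X v ∧
      ∀ w ∈ X, max (u w) ((-2 : ℝ) : EReal) = ((v w - 1 : ℝ) : EReal) := by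
  set g : En n → ℝ := fun w => (max (u w) ((-2 : ℝ) : EReal)).toReal with hg
  have hcoe : ∀ w ∈ X, (g w : EReal) = max (u w) ((-2 : ℝ) : EReal) := fun w hw => by
    refine EReal.coe_toReal (ne_of_lt ?_) (ne_of_gt ?_)
    · exact max_lt ((hneg w hw).trans (EReal.coe_lt_top 0)) (EReal.coe_lt_top _)
    · exact lt_max_of_lt_right (EReal.bot_lt_coe _)
  have hlow : ∀ w ∈ X, -2 ≤ g w := fun w hw => by
    rw [← EReal.coe_le_coe_iff, hcoe w hw]
    exact le_max_right _ _
  have hup : ∀ w ∈ X, g w ≤ 0 := fun w hw => by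
    rw [← EReal.coe_le_coe_iff, hcoe w hw]
    exact max_le (hneg w hw).le (EReal.coe_le_coe_iff.mpr (by norm_num))
  have hcont : ContinuousOn g X := by
    have h1 : ContinuousOn (fun w => (g w : EReal)) X :=
      (hu.2.sup continuousOn_const).congr fun w hw => hcoe w hw
    exact EReal.isEmbedding_coe.continuousOn_iff.mpr h1
  refine ⟨fun w => g w + 1, ⟨hcont.add continuousOn_const, fun w hw => ?_, ?_⟩, fun w hw => ?_⟩
  · rw [Real.norm_eq_abs, abs_le]
    constructor <;> linarith [hlow w hw, hup w hw]
  · intro x hx μ hμ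
    have := hμ.1
    have hgi := hμ.integrable hX hcont
    have h1 : u x ≤ ((∫ y, g y ∂μ : ℝ) : EReal) := by
      rw [← eint_coe hgi]
      refine (hu.1.2.2 x hx μ hμ).trans (eint_mono_ae (hμ.ae_mem.mono fun y hy => ?_))
      rw [hcoe y hy]
      exact le_max_left _ _
    have h2 : -2 ≤ ∫ y, g y ∂μ := by
      have := integral_mono_ae (integrable_const (-2 : ℝ)) hgi (hμ.ae_mem.mono hlow)
      simpa using this
    have h3 : g x ≤ ∫ y, g y ∂μ := by
      rw [← EReal.coe_le_coe_iff, hcoe x hx]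
      exact max_le h1 (EReal.coe_le_coe_iff.mpr h2)
    rw [integral_add hgi (integrable_const 1)]
    simpa using h3
  · rw [← hcoe w hw, add_sub_cancel_right]

theorem tsum_geometric_mul_neg {a : ℕ → ℝ} (hbd : ∀ k, ‖a k‖ ≤ 1)
    (hor : ∀ k, a k ≤ -1 ∨ ∑ i ∈ Finset.range k, (2 / 3 : ℝ) ^ i * a i < (2 / 3) ^ k / 2)
    (hev : ∃ N, ∀ k, N ≤ k → a k ≤ -1) : ∑' k, (2 / 3 : ℝ) ^ k * a k < 0 := by
  classical
  have hgeo : HasSum (fun k : ℕ => (2 / 3 : ℝ) ^ k) 3 := by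
    convert hasSum_geometric_of_lt_one (r := (2 / 3 : ℝ)) (by norm_num) (by norm_num) using 1
    norm_num
  have hsum : Summable fun k => (2 / 3 : ℝ) ^ k * a k := by
    refine Summable.of_norm_bounded hgeo.summable fun k => ?_
    rw [norm_mul, Real.norm_of_nonneg (by positivity)]
    exact mul_le_of_le_one_right (by positivity) (hbd k)
  have htail : ∀ N, (∀ k, N ≤ k → a k ≤ -1) →
      ∑' k, (2 / 3 : ℝ) ^ (k + N) * a (k + N) ≤ -(2 / 3) ^ N * 3 := fun N hN => by
    refine hasSum_le (fun k => ?_) ((summable_nat_add_iff N).mpr hsum).hasSum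
      (hgeo.mul_left (-(2 / 3 : ℝ) ^ N))
    have h1 := mul_le_mul_of_nonneg_left (hN (k + N) (Nat.le_add_left N k))
      (show (0 : ℝ) ≤ (2 / 3) ^ (k + N) by positivity)
    calc _ ≤ _ := h1
      _ = _ := by ring
  have hN := Nat.find_spec hev
  rcases hN0 : Nat.find hev with _ | j
  · rw [hN0] at hN
    have := htail 0 hN
    simp only [add_zero, pow_zero] at this
    linarith
  · rw [hN0] at hN
    have hj : ¬ a j ≤ -1 := fun hj => by
      refine Nat.find_min hev (m := j) (by omega) fun k hk => ?_
      rcases hk.eq_or_lt with rfl | hk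
      · exact hj
      · exact hN k hk
    have hS := (hor j).resolve_left hj
    have h1 := htail (j + 1) hN
    have h2 : (2 / 3 : ℝ) ^ j * a j ≤ (2 / 3) ^ j :=
      mul_le_of_le_one_right (by positivity) ((le_abs_self _).trans (hbd j))
    rw [← hsum.sum_add_tsum_nat_add (j + 1), Finset.sum_range_succ]
    have h3 : (0 : ℝ) < (2 / 3) ^ j := by positivity
    rw [pow_succ] at h1
    linarith

theorem exists_seq_partial_sum {E : Type*} [TopologicalSpace E] {X : Set E} {z : E}
    {P : ℕ → (E → ℝ) → (E → ℝ) → Prop}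
    (hP : ∀ j S, ContinuousOn S X → S z = 0 →
      ∃ v : E → ℝ, ContinuousOn v X ∧ v z = 0 ∧ P j S v) (r : ℝ) :
    ∃ v : ℕ → E → ℝ, ∀ j, v j z = 0 ∧
      P j (fun w => ∑ i ∈ Finset.range j, r ^ i * v i w) (v j) := by
  choose F hFc hFz hFP using hP
  let T : ℕ → {S : E → ℝ // ContinuousOn S X ∧ S z = 0} := fun j =>
    Nat.rec ⟨fun _ => 0, continuousOn_const, rfl⟩ (fun j S =>
      ⟨fun w => S.1 w + r ^ j * F j S.1 S.2.1 S.2.2 w,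
        S.2.1.add (continuousOn_const.mul (hFc j S.1 S.2.1 S.2.2)),
        by simp [S.2.2, hFz j S.1 S.2.1 S.2.2]⟩) j
  let v : ℕ → E → ℝ := fun j => F j (T j).1 (T j).2.1 (T j).2.2
  have hT : ∀ j, (T j).1 = fun w => ∑ i ∈ Finset.range j, r ^ i * v i w := by
    intro j
    induction j with
    | zero => simp [T]
    | succ j ih =>
      funext w
      rw [Finset.sum_range_succ, ← congrFun ih w]
  exact ⟨v, fun j => ⟨hFz _ _ _ _, hT j ▸ hFP j (T j).1 (T j).2.1 (T j).2.2⟩⟩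

theorem exists_unitSubaveraging_step {n : ℕ} {X : Set (En n)} (hX : IsCompact X) {z : En n}
    (hz : z ∈ X)
    (h : ∀ V : Set (En n), IsOpen V → z ∈ V →
      ∃ u : En n → EReal, PSHce X u ∧ (∀ w ∈ X, u w < 0) ∧ u z = ((-1 : ℝ) : EReal) ∧
        ∀ w ∈ X, w ∉ V → u w ≤ ((-2 : ℝ) : EReal))
    {S : En n → ℝ} (hS : ContinuousOn S X) (hSz : S z = 0) {δ ε : ℝ} (hδ : 0 < δ) (hε : 0 < ε) :
    ∃ v : En n → ℝ, UnitSubaveraging X v ∧ v z = 0 ∧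
      ∀ w ∈ X, v w ≤ -1 ∨ (dist w z < δ ∧ S w < ε) := by
  obtain ⟨O, hO, hOX⟩ := continuousOn_iff'.mp hS (Iio ε) isOpen_Iio
  have hmem : ∀ w ∈ X, (w ∈ O ↔ S w < ε) := fun w hw => by
    have := Set.ext_iff.mp hOX w
    simp only [mem_inter_iff, mem_preimage, mem_Iio, hw, and_true] at this
    exact this.symm
  obtain ⟨u, hu, hneg, huz, huV⟩ := h (ball z δ ∩ O) (isOpen_ball.inter hO)
    ⟨mem_ball_self hδ, (hmem z hz).mpr (hSz ▸ hε)⟩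
  obtain ⟨v, hv, hvu⟩ := exists_unitSubaveraging_of_psh hX hu hneg
  refine ⟨v, hv, ?_, fun w hw => ?_⟩
  · have h1 := hvu z hz
    rw [huz, max_eq_left (EReal.coe_le_coe_iff.mpr (by norm_num)), EReal.coe_eq_coe_iff] at h1
    linarith
  · by_cases hwV : w ∈ ball z δ ∩ O
    · exact Or.inr ⟨hwV.1, (hmem w hw).mp hwV.2⟩
    · left
      have h1 := hvu w hw
      rw [max_eq_right (huV w hw hwV), EReal.coe_eq_coe_iff] at h1
      linarith

theorem pshce_tsum_geometric {n : ℕ} {X : Set (En n)} (hX : IsCompact X) {v : ℕ → En n → ℝ}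
    (hv : ∀ j, UnitSubaveraging X (v j)) :
    PSHce X fun w => ((∑' j, (2 / 3 : ℝ) ^ j * v j w : ℝ) : EReal) := by
  have hgeo : Summable fun k : ℕ => (2 / 3 : ℝ) ^ k :=
    summable_geometric_of_lt_one (by norm_num) (by norm_num)
  have hnorm : ∀ j, ∀ w ∈ X, ‖(2 / 3 : ℝ) ^ j * v j w‖ ≤ (2 / 3) ^ j := fun j w hw => by
    rw [norm_mul, Real.norm_of_nonneg (by positivity)]
    exact mul_le_of_le_one_right (by positivity) ((hv j).norm_le w hw)
  have hterm : ∀ j, ContinuousOn (fun w => (2 / 3 : ℝ) ^ j * v j w) X := fun j =>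
    continuousOn_const.mul (hv j).continuousOn
  have hcont : ContinuousOn (fun w => ∑' j, (2 / 3 : ℝ) ^ j * v j w) X :=
    continuousOn_tsum hterm hgeo hnorm
  have hcontE := continuous_coe_real_ereal.comp_continuousOn hcont
  refine ⟨⟨hcontE.upperSemicontinuousOn, fun w _ => EReal.coe_lt_top _, ?_⟩, hcontE⟩
  intro x hx μ hμ
  have := hμ.1
  have hgi : ∀ j, Integrable (fun w => (2 / 3 : ℝ) ^ j * v j w) μ := fun j =>
    hμ.integrable hX (hterm j)
  have hsum : Summable fun j => ∫ w, ‖(2 / 3 : ℝ) ^ j * v j w‖ ∂μ := by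
    refine Summable.of_nonneg_of_le (fun j => integral_nonneg fun w => norm_nonneg _)
      (fun j => ?_) hgeo
    have := integral_mono_ae (hgi j).norm (integrable_const ((2 / 3 : ℝ) ^ j))
      (hμ.ae_mem.mono (hnorm j))
    simpa using this
  rw [eint_coe (hμ.integrable hX hcont), EReal.coe_le_coe_iff]
  have hI := hasSum_integral_of_summable_integral_norm hgi hsum
  refine hasSum_le (fun j => ?_) (Summable.of_norm_bounded hgeo fun j => hnorm j x hx).hasSum hI
  rw [integral_const_mul]
  exact mul_le_mul_of_nonneg_left ((hv j).le_integral x hx μ hμ) (by positivity)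

/-- Lemma 4.2. -/
theorem stmt_7 {n : ℕ} (X : Set (En n)) (hX : IsCompact X) (z : En n) (hz : z ∈ X)
    (h : ∀ V : Set (En n), IsOpen V → z ∈ V →
      ∃ u : En n → EReal, PSHce X u ∧ (∀ w ∈ X, u w < 0) ∧ u z = ((-1 : ℝ) : EReal) ∧
        ∀ w ∈ X, w ∉ V → u w ≤ ((-2 : ℝ) : EReal)) :
    ∃ u : En n → EReal, PSHce X u ∧ u z = 0 ∧ ∀ w ∈ X, w ≠ z → u w < 0 := by
  obtain ⟨v, hv⟩ := exists_seq_partial_sum (X := X) (z := z)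
    (P := fun j S v => UnitSubaveraging X v ∧
      ∀ w ∈ X, v w ≤ -1 ∨ (dist w z < 1 / ((j : ℝ) + 1) ∧ S w < (2 / 3) ^ j / 2))
    (fun j S hS hSz => by
      obtain ⟨v, hv, hvz, hvw⟩ := exists_unitSubaveraging_step hX hz h hS hSz
        (δ := 1 / ((j : ℝ) + 1)) (ε := (2 / 3) ^ j / 2) (by positivity) (by positivity)
      exact ⟨v, hv.continuousOn, hvz, hv, hvw⟩) (2 / 3)
  refine ⟨_, pshce_tsum_geometric hX fun j => (hv j).2.1, by simp [(hv _).1], fun w hw hwz => ?_⟩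
  refine EReal.coe_lt_coe_iff.mpr (tsum_geometric_mul_neg (fun k => (hv k).2.1.norm_le w hw)
    (fun k => ((hv k).2.2 w hw).imp_right And.right) ?_)
  obtain ⟨N, hN⟩ := exists_nat_one_div_lt (dist_pos.mpr hwz)
  refine ⟨N, fun k hk => ((hv k).2.2 w hw).resolve_right fun hk' => ?_⟩
  exact (hN.trans hk'.1).not_ge (Nat.one_div_le_one_div hk)
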